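/- In any 2-symmetric semi-Riemannian manifold (∇_μ∇_ν R^{α}_{βγδ} = 0), either the scalar curvature R is constant, or the gradient ∇_μ R is a null parallel 1-form. -/

import Mathlib

noncomputable section

open scoped BigOperators

/-! ## A local-coordinate framework for semi-Riemannian geometry

A semi-Riemannian manifold is described in a local chart: points are elements of
`Pt n := Fin n → ℝ`, a rank-`q` covariant tensor field is a map
`Pt n → (Fin q → Fin n) → ℝ`, the metric `g` (with inverse `ginv`) determines the
Christoffel symbols of its Levi-Civita connection, the covariant derivative `covD`,
and the Riemann, Ricci, scalar and Weyl curvatures. -/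

/-- Points of a local chart of an `n`-dimensional manifold. -/
abbrev Pt (n : ℕ) : Type := Fin n → ℝ

/-- A rank-`q` (covariant) tensor field, in the chart. -/
abbrev Tensor (n q : ℕ) : Type := Pt n → (Fin q → Fin n) → ℝ

/-- Partial derivative of a scalar field in the `i`-th coordinate direction. -/
def pd {n : ℕ} (i : Fin n) (f : Pt n → ℝ) (x : Pt n) : ℝ :=
  fderiv ℝ f x (Pi.single i 1)

/-- `g` is a smooth metric of arbitrary signature, with (smooth) inverse `ginv`. -/
def IsMetric {n : ℕ} (g ginv : Pt n → Fin n → Fin n → ℝ) : Prop :=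
  (∀ x μ ν, g x μ ν = g x ν μ) ∧
  (∀ μ ν, ContDiff ℝ (⊤ : ℕ∞) fun x => g x μ ν) ∧
  (∀ μ ν, ContDiff ℝ (⊤ : ℕ∞) fun x => ginv x μ ν) ∧
  (∀ x μ ν, (∑ ρ, ginv x μ ρ * g x ρ ν) = if μ = ν then (1 : ℝ) else 0)

/-- The metric `g` has Lorentzian signature `(-,+,…,+)`: at every point there is a
frame in which it takes the form `diag (-1, 1, …, 1)`. -/
def IsLorentzian {n : ℕ} (g : Pt n → Fin n → Fin n → ℝ) : Prop :=
  ∀ x, ∃ e : Fin n → Fin n → ℝ, ∀ μ ν : Fin n,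
    (∑ α, ∑ β, g x α β * e μ α * e ν β) =
      if μ = ν then (if μ.val = 0 then (-1 : ℝ) else 1) else 0

/-- Christoffel symbols `Γ^α_{βγ}` of the Levi-Civita connection of `g`. -/
def christoffel {n : ℕ} (g ginv : Pt n → Fin n → Fin n → ℝ) (x : Pt n) (α β γ : Fin n) : ℝ :=
  (1 / 2) * ∑ ρ, ginv x α ρ *
    (pd β (fun y => g y ρ γ) x + pd γ (fun y => g y ρ β) x - pd ρ (fun y => g y β γ) x)

/-- Covariant derivative of a rank-`q` covariant tensor field:
`(covD T)_{λ α₁ … α_q} = ∇_λ T_{α₁ … α_q}`; the derivative index comes first. -/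
def covD {n q : ℕ} (g ginv : Pt n → Fin n → Fin n → ℝ) (T : Tensor n q) :
    Tensor n (q + 1) := fun x idx =>
  pd (idx 0) (fun y => T y fun i => idx i.succ) x -
    ∑ i : Fin q, ∑ ρ, christoffel g ginv x ρ (idx 0) (idx i.succ) *
      T x (Function.update (fun j => idx j.succ) i ρ)

/-- Covariant derivative `∇_λ k^μ` of a vector field `k^μ`. -/
def covDVec {n : ℕ} (g ginv : Pt n → Fin n → Fin n → ℝ) (k : Pt n → Fin n → ℝ)
    (x : Pt n) (lam μ : Fin n) : ℝ :=
  pd lam (fun y => k y μ) x + ∑ ρ, christoffel g ginv x μ lam ρ * k x ρ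

/-- Riemann curvature tensor `R^α_{βγδ}` of the Levi-Civita connection of `g`. -/
def riemannUp {n : ℕ} (g ginv : Pt n → Fin n → Fin n → ℝ) (x : Pt n) (α β γ δ : Fin n) : ℝ :=
  pd γ (fun y => christoffel g ginv y α δ β) x - pd δ (fun y => christoffel g ginv y α γ β) x +
    ∑ ρ, (christoffel g ginv x α γ ρ * christoffel g ginv x ρ δ β -
          christoffel g ginv x α δ ρ * christoffel g ginv x ρ γ β)

/-- Fully covariant Riemann tensor `R_{αβγδ} = g_{αρ} R^ρ_{βγδ}`. -/
def riemann {n : ℕ} (g ginv : Pt n → Fin n → Fin n → ℝ) : Tensor n 4 := fun x idx =>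
  ∑ ρ, g x (idx 0) ρ * riemannUp g ginv x ρ (idx 1) (idx 2) (idx 3)

/-- Ricci tensor `R_{μν} = R^ρ_{μρν}`. -/
def ricci {n : ℕ} (g ginv : Pt n → Fin n → Fin n → ℝ) : Tensor n 2 := fun x idx =>
  ∑ ρ, riemannUp g ginv x ρ (idx 0) ρ (idx 1)

/-- Scalar curvature `R = g^{μν} R_{μν}`. -/
def scalarCurv {n : ℕ} (g ginv : Pt n → Fin n → Fin n → ℝ) (x : Pt n) : ℝ :=
  ∑ μ, ∑ ν, ginv x μ ν * ricci g ginv x ![μ, ν]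

/-- Weyl conformal tensor `C_{αβλμ}`, defined through the standard decomposition
`R_{αβλμ} = C_{αβλμ} + (2/(n-2)) (R_{α[λ} g_{μ]β} - R_{β[λ} g_{μ]α})
 - (R/((n-1)(n-2))) (g_{αλ} g_{βμ} - g_{αμ} g_{βλ})`. -/
def weyl {n : ℕ} (g ginv : Pt n → Fin n → Fin n → ℝ) : Tensor n 4 := fun x idx =>
  riemann g ginv x idx -
    (2 / ((n : ℝ) - 2)) *
      ((ricci g ginv x ![idx 0, idx 2] * g x (idx 3) (idx 1) -
        ricci g ginv x ![idx 0, idx 3] * g x (idx 2) (idx 1)) / 2 -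
       (ricci g ginv x ![idx 1, idx 2] * g x (idx 3) (idx 0) -
        ricci g ginv x ![idx 1, idx 3] * g x (idx 2) (idx 0)) / 2) +
    (scalarCurv g ginv x / (((n : ℝ) - 1) * ((n : ℝ) - 2))) *
      (g x (idx 0) (idx 2) * g x (idx 1) (idx 3) - g x (idx 0) (idx 3) * g x (idx 1) (idx 2))

/-- Second-order symmetry (2-symmetry): `∇_μ ∇_ν R_{αβγδ} = 0` everywhere. -/
def TwoSymmetric {n : ℕ} (g ginv : Pt n → Fin n → Fin n → ℝ) : Prop :=
  ∀ x idx, covD g ginv (covD g ginv (riemann g ginv)) x idx = 0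

/-- 2-symmetry on a set `D`: `∇_μ ∇_ν R_{αβγδ} = 0` on `D`. -/
def TwoSymmetricOn {n : ℕ} (g ginv : Pt n → Fin n → Fin n → ℝ) (D : Set (Pt n)) : Prop :=
  ∀ x ∈ D, ∀ idx, covD g ginv (covD g ginv (riemann g ginv)) x idx = 0

/-- Semi-symmetry: `∇_[μ ∇_ν] R_{αβγδ} = 0` everywhere. -/
def SemiSymmetric {n : ℕ} (g ginv : Pt n → Fin n → Fin n → ℝ) : Prop :=
  ∀ x (μ ν α β γ δ : Fin n),
    covD g ginv (covD g ginv (riemann g ginv)) x ![μ, ν, α, β, γ, δ] =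
    covD g ginv (covD g ginv (riemann g ginv)) x ![ν, μ, α, β, γ, δ]

/-- `p` is a generic point: the Riemann tensor at `p`, viewed as the endomorphism
`ω_{γδ} ↦ R^{αβ}_{γδ} ω_{γδ}` of the space of 2-forms at `p`, is non-singular. -/
def GenericAt {n : ℕ} (g ginv : Pt n → Fin n → Fin n → ℝ) (p : Pt n) : Prop :=
  ∀ ω : Fin n → Fin n → ℝ, (∀ γ δ, ω γ δ = -ω δ γ) →
    (∀ α β, (∑ γ, ∑ δ, (∑ σ, ginv p β σ * riemannUp g ginv p α σ γ δ) * ω γ δ) = 0) →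
    ω = 0

/-- `k` is a parallel null (nowhere zero) vector field on `D`. -/
def ParallelNullVectorFieldOn {n : ℕ} (g ginv : Pt n → Fin n → Fin n → ℝ)
    (D : Set (Pt n)) (k : Pt n → Fin n → ℝ) : Prop :=
  (∀ x ∈ D, ∀ lam μ, covDVec g ginv k x lam μ = 0) ∧
  (∀ x ∈ D, (∑ μ, ∑ ν, g x μ ν * k x μ * k x ν) = 0) ∧
  (∀ x ∈ D, k x ≠ 0)

/-- Pullback metric of `g` along a coordinate change `φ`. -/
def pullback {n : ℕ} (g : Pt n → Fin n → Fin n → ℝ) (φ : Pt n → Pt n)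
    (x : Pt n) (μ ν : Fin n) : ℝ :=
  ∑ α, ∑ β, g (φ x) α β * pd μ (fun y => φ y α) x * pd ν (fun y => φ y β) x

/-- `k`-th iterated covariant derivative of a rank-`q` tensor field. -/
def covDIter {n : ℕ} (g ginv : Pt n → Fin n → Fin n → ℝ) (q : ℕ) :
    (k : ℕ) → Tensor n q → Tensor n (q + k)
  | 0, T => T
  | k + 1, T => covD g ginv (covDIter g ginv q k T)

/-- Totally antisymmetric Levi-Civita symbol. -/
def lcSymbol {n : ℕ} (idx : Fin n → Fin n) : ℝ :=
  if h : Function.Bijective idx then ((Equiv.Perm.sign (Equiv.ofBijective idx h) : ℤ) : ℝ) else 0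

/-- The metric volume element `n`-form `√|det g| ε_{μ₁…μ_n}`. -/
def volForm {n : ℕ} (g : Pt n → Fin n → Fin n → ℝ) : Tensor n n := fun x idx =>
  Real.sqrt |Matrix.det (Matrix.of (g x))| * lcSymbol idx

/-- Formal curvature invariants of rank `q`: tensor fields constructed polynomially
from the metric, its inverse, the Riemann tensor, the volume `n`-form, covariant
derivatives, tensor products, (metric) contractions, index permutations, sums and
scalar multiples. -/
inductive TExpr (n : ℕ) : ℕ → Type where
  | metric : TExpr n 2
  | inv : TExpr n 2
  | riem : TExpr n 4
  | eps : TExpr n n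
  | cd : {q : ℕ} → TExpr n q → TExpr n (q + 1)
  | tprod : {q r : ℕ} → TExpr n q → TExpr n r → TExpr n (q + r)
  | contr : {q : ℕ} → TExpr n (q + 2) → TExpr n q
  | permute : {q : ℕ} → Equiv.Perm (Fin q) → TExpr n q → TExpr n q
  | add : {q : ℕ} → TExpr n q → TExpr n q → TExpr n q
  | smul : {q : ℕ} → ℝ → TExpr n q → TExpr n q

/-- Evaluation of a formal curvature invariant as a tensor field. -/
def TExpr.eval {n : ℕ} (g ginv : Pt n → Fin n → Fin n → ℝ) :
    {q : ℕ} → TExpr n q → Tensor n q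
  | _, .metric => fun x idx => g x (idx 0) (idx 1)
  | _, .inv => fun x idx => ginv x (idx 0) (idx 1)
  | _, .riem => riemann g ginv
  | _, .eps => volForm g
  | _, .cd e => covD g ginv (TExpr.eval g ginv e)
  | _, .tprod e₁ e₂ => fun x idx =>
      TExpr.eval g ginv e₁ x (fun i => idx (Fin.castAdd _ i)) *
      TExpr.eval g ginv e₂ x (fun i => idx (Fin.natAdd _ i))
  | _, .contr e => fun x idx =>
      ∑ ρ, ∑ σ, ginv x ρ σ * TExpr.eval g ginv e x (Fin.cons ρ (Fin.cons σ idx))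
  | _, .permute π e => fun x idx => TExpr.eval g ginv e x (idx ∘ π)
  | _, .add e₁ e₂ => fun x idx => TExpr.eval g ginv e₁ x idx + TExpr.eval g ginv e₂ x idx
  | _, .smul c e => fun x idx => c * TExpr.eval g ginv e x idx

/-- `e.HasOrderDeg m d`: the invariant `e` is homogeneous of order `m` (number of
covariant derivatives in each term) and degree `d` (number of Riemann factors in
each term). -/
inductive TExpr.HasOrderDeg {n : ℕ} : {q : ℕ} → TExpr n q → ℕ → ℕ → Prop where
  | metric : HasOrderDeg .metric 0 0
  | inv : HasOrderDeg .inv 0 0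
  | riem : HasOrderDeg .riem 0 1
  | eps : HasOrderDeg .eps 0 0
  | cd {q : ℕ} {e : TExpr n q} {m d : ℕ} : HasOrderDeg e m d → HasOrderDeg e.cd (m + 1) d
  | tprod {q r : ℕ} {e₁ : TExpr n q} {e₂ : TExpr n r} {m₁ d₁ m₂ d₂ : ℕ} :
      HasOrderDeg e₁ m₁ d₁ → HasOrderDeg e₂ m₂ d₂ →
      HasOrderDeg (e₁.tprod e₂) (m₁ + m₂) (d₁ + d₂)
  | contr {q : ℕ} {e : TExpr n (q + 2)} {m d : ℕ} : HasOrderDeg e m d → HasOrderDeg e.contr m d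
  | permute {q : ℕ} {π : Equiv.Perm (Fin q)} {e : TExpr n q} {m d : ℕ} :
      HasOrderDeg e m d → HasOrderDeg (e.permute π) m d
  | add {q : ℕ} {e₁ e₂ : TExpr n q} {m d : ℕ} :
      HasOrderDeg e₁ m d → HasOrderDeg e₂ m d → HasOrderDeg (e₁.add e₂) m d
  | smul {q : ℕ} {c : ℝ} {e : TExpr n q} {m d : ℕ} :
      HasOrderDeg e m d → HasOrderDeg (e.smul c) m d

/-- `P` is the parallel-transport operator along the curve `γ`. -/
def IsTransportAlong {n : ℕ} (g ginv : Pt n → Fin n → Fin n → ℝ)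
    (γ : ℝ → Pt n) (P : ℝ → Fin n → Fin n → ℝ) : Prop :=
  (∀ μ ν, P 0 μ ν = if μ = ν then (1 : ℝ) else 0) ∧
  ∀ t μ ν, HasDerivAt (fun s => P s μ ν)
    (-∑ lam, ∑ ρ, christoffel g ginv (γ t) μ lam ρ * deriv (fun s => γ s lam) t * P t ρ ν) t

/-- The subspace `W` of the tangent space at `p` is invariant under the holonomy
group of `(D, g)` at `p` (parallel transport around smooth loops in `D` based at `p`). -/
def HolonomyInvariantAt {n : ℕ} (g ginv : Pt n → Fin n → Fin n → ℝ) (D : Set (Pt n))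
    (p : Pt n) (W : Submodule ℝ (Fin n → ℝ)) : Prop :=
  ∀ γ : ℝ → Pt n, ContDiff ℝ (⊤ : ℕ∞) γ → (∀ t, γ t ∈ D) → γ 0 = p → γ 1 = p →
    ∀ P, IsTransportAlong g ginv γ P →
      ∀ w ∈ W, (fun μ => ∑ ν, P 1 μ ν * w ν) ∈ W

/-- The holonomy group of `(D,g)` at `p` is reducible: it leaves invariant a
non-trivial subspace of the tangent space. -/
def ReducibleAt {n : ℕ} (g ginv : Pt n → Fin n → Fin n → ℝ) (D : Set (Pt n))
    (p : Pt n) : Prop :=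
  ∃ W : Submodule ℝ (Fin n → ℝ), W ≠ ⊥ ∧ W ≠ ⊤ ∧ HolonomyInvariantAt g ginv D p W

/-- The holonomy group of `(D,g)` at `p` is non-degenerately reducible: it leaves
invariant a non-trivial subspace on which `g` is non-degenerate. -/
def NonDegReducibleAt {n : ℕ} (g ginv : Pt n → Fin n → Fin n → ℝ) (D : Set (Pt n))
    (p : Pt n) : Prop :=
  ∃ W : Submodule ℝ (Fin n → ℝ), W ≠ ⊥ ∧ W ≠ ⊤ ∧ HolonomyInvariantAt g ginv D p W ∧
    ∀ w ∈ W, (∀ u ∈ W, (∑ μ, ∑ ν, g p μ ν * w μ * u ν) = 0) → w = 0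



/-! ## Calculus of partial derivatives -/

section Calculus

variable {n : ℕ}

lemma ContDiff.differentiableAt_top {f : Pt n → ℝ} (hf : ContDiff ℝ (⊤ : ℕ∞) f) (x : Pt n) :
    DifferentiableAt ℝ f x :=
  (hf.differentiable (by simp)).differentiableAt

lemma ContDiff.pd {f : Pt n → ℝ} (hf : ContDiff ℝ (⊤ : ℕ∞) f) (i : Fin n) :
    ContDiff ℝ (⊤ : ℕ∞) (fun x => pd i f x) :=
  (hf.fderiv_right (m := ((⊤ : ℕ∞) : WithTop ℕ∞)) (by simp)).clm_apply contDiff_const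

lemma pd_add {f h : Pt n → ℝ} (hf : ContDiff ℝ (⊤ : ℕ∞) f) (hh : ContDiff ℝ (⊤ : ℕ∞) h)
    (i : Fin n) (x : Pt n) : pd i (fun y => f y + h y) x = pd i f x + pd i h x := by
  simp [pd, fderiv_fun_add (hf.differentiableAt_top x) (hh.differentiableAt_top x)]

lemma pd_sub {f h : Pt n → ℝ} (hf : ContDiff ℝ (⊤ : ℕ∞) f) (hh : ContDiff ℝ (⊤ : ℕ∞) h)
    (i : Fin n) (x : Pt n) : pd i (fun y => f y - h y) x = pd i f x - pd i h x := by
  simp [pd, fderiv_fun_sub (hf.differentiableAt_top x) (hh.differentiableAt_top x)]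

lemma pd_mul {f h : Pt n → ℝ} (hf : ContDiff ℝ (⊤ : ℕ∞) f) (hh : ContDiff ℝ (⊤ : ℕ∞) h)
    (i : Fin n) (x : Pt n) :
    pd i (fun y => f y * h y) x = pd i f x * h x + f x * pd i h x := by
  simp [pd, fderiv_fun_mul (hf.differentiableAt_top x) (hh.differentiableAt_top x)]
  ring

lemma pd_const (c : ℝ) (i : Fin n) (x : Pt n) : pd i (fun _ => c) x = 0 := by
  simp [pd]

lemma pd_sum {ι : Type*} (s : Finset ι) {f : ι → Pt n → ℝ}
    (hf : ∀ a, ContDiff ℝ (⊤ : ℕ∞) (f a)) (i : Fin n) (x : Pt n) :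
    pd i (fun y => ∑ a ∈ s, f a y) x = ∑ a ∈ s, pd i (f a) x := by
  simp [pd, fderiv_fun_sum fun a _ => (hf a).differentiableAt_top x]

lemma pd_comm {f : Pt n → ℝ} (hf : ContDiff ℝ (⊤ : ℕ∞) f) (i j : Fin n) (x : Pt n) :
    pd i (fun y => pd j f y) x = pd j (fun y => pd i f y) x := by
  have hd : DifferentiableAt ℝ (fderiv ℝ f) x :=
    ((hf.fderiv_right (m := ((⊤ : ℕ∞) : WithTop ℕ∞)) (by simp)).differentiable
      (by simp)).differentiableAt
  have hs : IsSymmSndFDerivAt ℝ f x :=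
    hf.contDiffAt.isSymmSndFDerivAt (by
      rw [minSmoothness_of_isRCLikeNormedField]
      exact (WithTop.coe_le_coe.2 le_top : ((2 : ℕ∞) : WithTop ℕ∞) ≤ _))
  have key : ∀ u v : Pt n, fderiv ℝ (fun y => fderiv ℝ f y u) x v = fderiv ℝ (fderiv ℝ f) x v u := by
    intro u v
    rw [fderiv_clm_apply hd (differentiableAt_const u)]
    simp
  simp only [pd, key]
  exact hs _ _

/-! ### Matrix-valued functions -/

/-- A matrix-valued function with smooth entries. -/
def SmoothMat {ι κ : Type*} (A : Pt n → Matrix ι κ ℝ) : Prop :=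
  ∀ a b, ContDiff ℝ (⊤ : ℕ∞) fun x => A x a b

/-- Entrywise partial derivative of a matrix-valued function. -/
def matPd {ι κ : Type*} (i : Fin n) (A : Pt n → Matrix ι κ ℝ) (x : Pt n) : Matrix ι κ ℝ :=
  Matrix.of fun a b => pd i (fun y => A y a b) x

variable {ι κ τ : Type*}

lemma SmoothMat.matPd {A : Pt n → Matrix ι κ ℝ} (hA : SmoothMat A) (i : Fin n) :
    SmoothMat (fun x => matPd i A x) := fun a b => (hA a b).pd i

lemma SmoothMat.add {A B : Pt n → Matrix ι κ ℝ} (hA : SmoothMat A) (hB : SmoothMat B) :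
    SmoothMat (fun x => A x + B x) := fun a b => (hA a b).add (hB a b)

lemma SmoothMat.sub {A B : Pt n → Matrix ι κ ℝ} (hA : SmoothMat A) (hB : SmoothMat B) :
    SmoothMat (fun x => A x - B x) := fun a b => (hA a b).sub (hB a b)

lemma SmoothMat.mul [Fintype κ] {A : Pt n → Matrix ι κ ℝ} {B : Pt n → Matrix κ τ ℝ}
    (hA : SmoothMat A) (hB : SmoothMat B) : SmoothMat (fun x => A x * B x) := fun a b => by
  simp only [Matrix.mul_apply]
  exact ContDiff.sum fun c _ => (hA a c).mul (hB c b)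

lemma SmoothMat.transpose {A : Pt n → Matrix ι κ ℝ} (hA : SmoothMat A) :
    SmoothMat (fun x => (A x).transpose) := fun a b => hA b a

lemma matPd_add {A B : Pt n → Matrix ι κ ℝ} (hA : SmoothMat A) (hB : SmoothMat B)
    (i : Fin n) (x : Pt n) : matPd i (fun y => A y + B y) x = matPd i A x + matPd i B x := by
  ext a b
  exact pd_add (hA a b) (hB a b) i x

lemma matPd_sub {A B : Pt n → Matrix ι κ ℝ} (hA : SmoothMat A) (hB : SmoothMat B)
    (i : Fin n) (x : Pt n) : matPd i (fun y => A y - B y) x = matPd i A x - matPd i B x := by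
  ext a b
  exact pd_sub (hA a b) (hB a b) i x

lemma matPd_neg (A : Pt n → Matrix ι κ ℝ) (i : Fin n) (x : Pt n) :
    matPd i (fun y => -A y) x = -matPd i A x := by
  ext a b
  simp [matPd, pd, fderiv_fun_neg]

lemma matPd_mul [Fintype κ] {A : Pt n → Matrix ι κ ℝ} {B : Pt n → Matrix κ τ ℝ}
    (hA : SmoothMat A) (hB : SmoothMat B) (i : Fin n) (x : Pt n) :
    matPd i (fun y => A y * B y) x = matPd i A x * B x + A x * matPd i B x := by
  ext a b
  simp only [matPd, Matrix.of_apply, Matrix.mul_apply, Matrix.add_apply]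
  rw [pd_sum _ fun c => (hA a c).mul (hB c b), ← Finset.sum_add_distrib]
  exact Finset.sum_congr rfl fun c _ => pd_mul (hA a c) (hB c b) i x

lemma matPd_transpose (A : Pt n → Matrix ι κ ℝ) (i : Fin n) (x : Pt n) :
    matPd i (fun y => (A y).transpose) x = (matPd i A x).transpose := rfl

lemma matPd_const (C : Matrix ι κ ℝ) (i : Fin n) (x : Pt n) :
    matPd i (fun _ => C) x = 0 := by
  ext a b
  exact pd_const _ i x

lemma matPd_comm {A : Pt n → Matrix ι κ ℝ} (hA : SmoothMat A) (i j : Fin n) (x : Pt n) :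
    matPd i (fun y => matPd j A y) x = matPd j (fun y => matPd i A y) x := by
  ext a b
  exact pd_comm (hA a b) i j x

end Calculus

/-! ## The Levi-Civita connection in matrix form -/

section Connection

variable {n : ℕ}

/-- The metric as a matrix-valued function. -/
def metricMat (g : Pt n → Fin n → Fin n → ℝ) (x : Pt n) : Matrix (Fin n) (Fin n) ℝ :=
  Matrix.of (g x)

/-- The connection matrix `(Γ_γ)^α_β`. -/
def connMat (g ginv : Pt n → Fin n → Fin n → ℝ) (γ : Fin n) (x : Pt n) :
    Matrix (Fin n) (Fin n) ℝ :=
  Matrix.of fun α β => christoffel g ginv x α γ β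

/-- The curvature matrix `(Ω_{γδ})^α_β = R^α_{βγδ}`. -/
def curvMat (g ginv : Pt n → Fin n → Fin n → ℝ) (γ δ : Fin n) (x : Pt n) :
    Matrix (Fin n) (Fin n) ℝ :=
  matPd γ (connMat g ginv δ) x - matPd δ (connMat g ginv γ) x +
    (connMat g ginv γ x * connMat g ginv δ x - connMat g ginv δ x * connMat g ginv γ x)

variable {g ginv : Pt n → Fin n → Fin n → ℝ}

lemma curvMat_apply (x : Pt n) (α β γ δ : Fin n) :
    curvMat g ginv γ δ x α β = riemannUp g ginv x α β γ δ := by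
  simp [curvMat, riemannUp, matPd, connMat, Matrix.mul_apply]

lemma IsMetric.inv_mul (hg : IsMetric g ginv) (x : Pt n) :
    metricMat ginv x * metricMat g x = 1 := by
  ext a b
  simpa [metricMat, Matrix.mul_apply, Matrix.one_apply] using hg.2.2.2 x a b

lemma IsMetric.mul_inv (hg : IsMetric g ginv) (x : Pt n) :
    metricMat g x * metricMat ginv x = 1 :=
  mul_eq_one_comm.mp (hg.inv_mul x)

lemma IsMetric.transpose_metricMat (hg : IsMetric g ginv) (x : Pt n) :
    (metricMat g x).transpose = metricMat g x := by
  ext a b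
  exact hg.1 x b a

lemma IsMetric.transpose_inv (hg : IsMetric g ginv) (x : Pt n) :
    (metricMat ginv x).transpose = metricMat ginv x := by
  have h : (metricMat ginv x).transpose * metricMat g x = 1 := by
    have h1 := congrArg Matrix.transpose (hg.mul_inv x)
    rwa [Matrix.transpose_mul, hg.transpose_metricMat, Matrix.transpose_one] at h1
  calc (metricMat ginv x).transpose
      = (metricMat ginv x).transpose * (metricMat g x * metricMat ginv x) := by
        rw [hg.mul_inv, mul_one]
    _ = metricMat ginv x := by rw [← mul_assoc, h, one_mul]

lemma IsMetric.ginv_symm (hg : IsMetric g ginv) (x : Pt n) (μ ν : Fin n) :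
    ginv x μ ν = ginv x ν μ :=
  congrFun (congrFun (hg.transpose_inv x) ν) μ

lemma IsMetric.christoffel_symm (hg : IsMetric g ginv) (x : Pt n) (α β γ : Fin n) :
    christoffel g ginv x α β γ = christoffel g ginv x α γ β := by
  have h : (fun y => g y β γ) = fun y => g y γ β := funext fun y => hg.1 y β γ
  simp only [christoffel]
  congr 1
  refine Finset.sum_congr rfl fun ρ _ => ?_
  rw [show pd ρ (fun y => g y β γ) x = pd ρ (fun y => g y γ β) x by
    exact congrArg (fun f => pd ρ f x) h]
  ring

lemma IsMetric.lower_christoffel (hg : IsMetric g ginv) (x : Pt n) (σ β γ : Fin n) :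
    ∑ ρ, g x σ ρ * christoffel g ginv x ρ β γ =
      (1 / 2) * (pd β (fun y => g y σ γ) x + pd γ (fun y => g y σ β) x -
        pd σ (fun y => g y β γ) x) := by
  have h : ∀ v : Fin n → ℝ, ∑ ρ, g x σ ρ * ∑ τ, ginv x ρ τ * v τ = v σ := by
    intro v
    have := congrFun (congrArg (fun M => Matrix.mulVec M v) (hg.mul_inv x)) σ
    simp only [← Matrix.mulVec_mulVec, Matrix.one_mulVec] at this
    simpa [Matrix.mulVec, dotProduct, metricMat] using this
  rw [← h fun σ => (1 / 2) * (pd β (fun y => g y σ γ) x + pd γ (fun y => g y σ β) x -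
        pd σ (fun y => g y β γ) x)]
  refine Finset.sum_congr rfl fun ρ _ => ?_
  simp only [christoffel, Finset.mul_sum]
  refine Finset.sum_congr rfl fun τ _ => ?_
  ring

lemma IsMetric.smooth_metricMat (hg : IsMetric g ginv) : SmoothMat (metricMat g) :=
  hg.2.1

lemma IsMetric.smooth_inv (hg : IsMetric g ginv) : SmoothMat (metricMat ginv) :=
  hg.2.2.1

lemma IsMetric.smooth_connMat (hg : IsMetric g ginv) (γ : Fin n) :
    SmoothMat (connMat g ginv γ) := fun α β => by
  have h := hg.2.1
  have h' := hg.2.2.1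
  exact contDiff_const.mul (ContDiff.sum fun ρ _ => (h' α ρ).mul
    ((((h ρ β).pd γ).add ((h ρ γ).pd β)).sub ((h γ β).pd ρ)))

lemma IsMetric.smooth_curvMat (hg : IsMetric g ginv) (γ δ : Fin n) :
    SmoothMat (curvMat g ginv γ δ) :=
  have h := hg.smooth_connMat
  (((h δ).matPd γ).sub ((h γ).matPd δ)).add (((h γ).mul (h δ)).sub ((h δ).mul (h γ)))

/-- Metric compatibility `∇g = 0`. -/
lemma IsMetric.matPd_metricMat (hg : IsMetric g ginv) (γ : Fin n) (x : Pt n) :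
    matPd γ (metricMat g) x =
      (connMat g ginv γ x).transpose * metricMat g x + metricMat g x * connMat g ginv γ x := by
  ext a b
  have h1 := hg.lower_christoffel x a γ b
  have h2 := hg.lower_christoffel x b γ a
  have s : ∀ i p q, pd i (fun y => g y p q) x = pd i (fun y => g y q p) x := fun i p q =>
    congrArg (fun f => pd i f x) (funext fun y => hg.1 y p q)
  have h3 : ∑ ρ, christoffel g ginv x ρ γ a * g x ρ b =
      ∑ ρ, g x b ρ * christoffel g ginv x ρ γ a :=
    Finset.sum_congr rfl fun ρ _ => by rw [hg.1 x ρ b, mul_comm]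
  simp only [matPd, metricMat, connMat, Matrix.of_apply, Matrix.add_apply, Matrix.mul_apply,
    Matrix.transpose_apply]
  rw [h3, h1, h2, s γ b a, s b a γ, s a b γ]
  ring

/-- Compatibility of the inverse metric, `∇g⁻¹ = 0`. -/
lemma IsMetric.matPd_inv (hg : IsMetric g ginv) (γ : Fin n) (x : Pt n) :
    matPd γ (metricMat ginv) x =
      -(connMat g ginv γ x * metricMat ginv x +
        metricMat ginv x * (connMat g ginv γ x).transpose) := by
  have h := matPd_mul hg.smooth_inv hg.smooth_metricMat γ x
  rw [show (fun y => metricMat ginv y * metricMat g y) = fun _ => 1 from funext hg.inv_mul,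
    matPd_const, hg.matPd_metricMat] at h
  have h' := congrArg (· * metricMat ginv x) h
  simp only [zero_mul, add_mul, mul_add, mul_assoc, hg.mul_inv, mul_one] at h'
  rw [← mul_assoc (metricMat ginv x) (metricMat g x), hg.inv_mul, one_mul] at h'
  rw [eq_neg_iff_add_eq_zero, h']
  abel

lemma curvMat_antisymm (γ δ : Fin n) (x : Pt n) :
    curvMat g ginv γ δ x = -curvMat g ginv δ γ x := by
  simp only [curvMat]
  abel

/-- The curvature preserves the metric: `R_{αβγδ} = -R_{βαγδ}`. -/
lemma IsMetric.curvMat_skew (hg : IsMetric g ginv) (γ δ : Fin n) (x : Pt n) :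
    (curvMat g ginv γ δ x).transpose * metricMat g x + metricMat g x * curvMat g ginv γ δ x
      = 0 := by
  have hG := hg.smooth_metricMat
  have hC := hg.smooth_connMat
  have key : ∀ γ δ, matPd γ (fun y => matPd δ (metricMat g) y) x =
      (matPd γ (connMat g ginv δ) x).transpose * metricMat g x +
      (connMat g ginv δ x).transpose * ((connMat g ginv γ x).transpose * metricMat g x +
        metricMat g x * connMat g ginv γ x) +
      (((connMat g ginv γ x).transpose * metricMat g x + metricMat g x * connMat g ginv γ x) *
        connMat g ginv δ x + metricMat g x * matPd γ (connMat g ginv δ) x) := by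
    intro γ δ
    rw [funext fun y => hg.matPd_metricMat δ y,
      matPd_add ((hC δ).transpose.mul hG) (hG.mul (hC δ)), matPd_mul (hC δ).transpose hG,
      matPd_mul hG (hC δ), matPd_transpose, hg.matPd_metricMat]
  have h := matPd_comm hG γ δ x
  rw [key, key, ← sub_eq_zero] at h
  rw [← h]
  simp only [curvMat, Matrix.transpose_add, Matrix.transpose_sub, Matrix.transpose_mul]
  noncomm_ring

/-- Ricci identity for parallel one-forms, written as columns. -/
lemma IsMetric.curvMat_transpose_mul_eq_zero (hg : IsMetric g ginv) {κ : Type*}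
    {w : Pt n → Matrix (Fin n) κ ℝ} (hw : SmoothMat w)
    (hp : ∀ γ x, matPd γ w x = (connMat g ginv γ x).transpose * w x)
    (γ δ : Fin n) (x : Pt n) : (curvMat g ginv γ δ x).transpose * w x = 0 := by
  have hC := hg.smooth_connMat
  have key : ∀ γ δ, matPd γ (fun y => matPd δ w y) x =
      (matPd γ (connMat g ginv δ) x).transpose * w x +
      (connMat g ginv δ x).transpose * ((connMat g ginv γ x).transpose * w x) := by
    intro γ δ
    rw [funext fun y => hp δ y, matPd_mul (hC δ).transpose hw, matPd_transpose, hp]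
  have h := matPd_comm hw γ δ x
  rw [key, key, ← sub_eq_zero] at h
  rw [← h]
  simp only [curvMat, Matrix.transpose_add, Matrix.transpose_sub, Matrix.transpose_mul,
    Matrix.add_mul, Matrix.sub_mul, Matrix.mul_assoc]
  abel

/-- Differential Bianchi identity. -/
lemma IsMetric.bianchi (hg : IsMetric g ginv) (l γ δ : Fin n) (x : Pt n) :
    (matPd l (curvMat g ginv γ δ) x + connMat g ginv l x * curvMat g ginv γ δ x -
        curvMat g ginv γ δ x * connMat g ginv l x) +
      (matPd γ (curvMat g ginv δ l) x + connMat g ginv γ x * curvMat g ginv δ l x -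
        curvMat g ginv δ l x * connMat g ginv γ x) +
      (matPd δ (curvMat g ginv l γ) x + connMat g ginv δ x * curvMat g ginv l γ x -
        curvMat g ginv l γ x * connMat g ginv δ x) = 0 := by
  have h := hg.smooth_connMat
  have key : ∀ l γ δ, matPd l (curvMat g ginv γ δ) x =
      matPd l (fun y => matPd γ (connMat g ginv δ) y) x -
      matPd l (fun y => matPd δ (connMat g ginv γ) y) x +
      ((matPd l (connMat g ginv γ) x * connMat g ginv δ x +
        connMat g ginv γ x * matPd l (connMat g ginv δ) x) -
       (matPd l (connMat g ginv δ) x * connMat g ginv γ x +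
        connMat g ginv δ x * matPd l (connMat g ginv γ) x)) := by
    intro l γ δ
    rw [← matPd_mul (h γ) (h δ), ← matPd_mul (h δ) (h γ),
      ← matPd_sub ((h γ).mul (h δ)) ((h δ).mul (h γ)),
      ← matPd_sub ((h δ).matPd γ) ((h γ).matPd δ),
      ← matPd_add (((h δ).matPd γ).sub ((h γ).matPd δ)) (((h γ).mul (h δ)).sub ((h δ).mul (h γ)))]
    rfl
  rw [key, key, key, matPd_comm (h δ) l γ, matPd_comm (h l) γ δ, matPd_comm (h γ) δ l]
  simp only [curvMat]
  noncomm_ring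

/-- Algebraic Bianchi identity. -/
lemma IsMetric.algebraic_bianchi (hg : IsMetric g ginv) (x : Pt n) (α β γ δ : Fin n) :
    riemannUp g ginv x α β γ δ + riemannUp g ginv x α γ δ β + riemannUp g ginv x α δ β γ = 0 := by
  have s : ∀ i a b c, pd i (fun y => christoffel g ginv y a b c) x =
      pd i (fun y => christoffel g ginv y a c b) x := fun i a b c =>
    congrArg (fun f => pd i f x) (funext fun y => hg.christoffel_symm y a b c)
  simp only [riemannUp, Finset.sum_sub_distrib]
  have t : ∀ a b c d, ∑ ρ, christoffel g ginv x a b ρ * christoffel g ginv x ρ c d =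
      ∑ ρ, christoffel g ginv x a b ρ * christoffel g ginv x ρ d c := fun a b c d =>
    Finset.sum_congr rfl fun ρ _ => by rw [hg.christoffel_symm x ρ c d]
  rw [s γ α δ β, s δ α γ β, s β α δ γ, t α γ δ β, t α δ γ β, t α β δ γ]
  ring

end Connection

/-! ## Contraction commutes with covariant differentiation -/

section Contraction

variable {n : ℕ} {g ginv : Pt n → Fin n → Fin n → ℝ}

lemma covD_one (T : Tensor n 1) (x : Pt n) (idx : Fin 2 → Fin n) :
    covD g ginv T x idx = pd (idx 0) (fun y => T y ![idx 1]) x -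
      ∑ ρ, christoffel g ginv x ρ (idx 0) (idx 1) * T x ![ρ] := by
  have e : (fun i : Fin 1 => idx i.succ) = ![idx 1] := by
    ext i
    fin_cases i
    rfl
  have u : ∀ ρ, Function.update ![idx 1] 0 ρ = ![ρ] := fun ρ => by
    ext i
    fin_cases i
    rfl
  simp only [covD, e, Fin.sum_univ_one, u]
  rfl

lemma covD_four (T : Tensor n 4) (x : Pt n) (l a b c d : Fin n) :
    covD g ginv T x ![l, a, b, c, d] = pd l (fun y => T y ![a, b, c, d]) x -
      ∑ ρ, christoffel g ginv x ρ l a * T x ![ρ, b, c, d] -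
      ∑ ρ, christoffel g ginv x ρ l b * T x ![a, ρ, c, d] -
      ∑ ρ, christoffel g ginv x ρ l c * T x ![a, b, ρ, d] -
      ∑ ρ, christoffel g ginv x ρ l d * T x ![a, b, c, ρ] := by
  have e : (fun i : Fin 4 => (![l, a, b, c, d] : Fin 5 → Fin n) i.succ) = ![a, b, c, d] := by
    ext i
    fin_cases i <;> rfl
  have u : ∀ ρ, Function.update ![a, b, c, d] 0 ρ = ![ρ, b, c, d] ∧
      Function.update ![a, b, c, d] 1 ρ = ![a, ρ, c, d] ∧
      Function.update ![a, b, c, d] 2 ρ = ![a, b, ρ, d] ∧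
      Function.update ![a, b, c, d] 3 ρ = ![a, b, c, ρ] := fun ρ => by
    refine ⟨?_, ?_, ?_, ?_⟩ <;> ext i <;> fin_cases i <;> rfl
  simp only [covD, e, Fin.sum_univ_four, u, ← sub_sub]
  rfl

lemma covD_five (T : Tensor n 5) (x : Pt n) (m l a b c d : Fin n) :
    covD g ginv T x ![m, l, a, b, c, d] =
      covD g ginv (fun y idx => T y ![l, idx 0, idx 1, idx 2, idx 3] : Tensor n 4) x
        ![m, a, b, c, d] -
      ∑ ρ, christoffel g ginv x ρ m l * T x ![ρ, a, b, c, d] := by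
  have e : (fun i : Fin 5 => (![m, l, a, b, c, d] : Fin 6 → Fin n) i.succ) = ![l, a, b, c, d] := by
    ext i
    fin_cases i <;> rfl
  have u : ∀ ρ, Function.update ![l, a, b, c, d] 0 ρ = ![ρ, a, b, c, d] ∧
      Function.update ![l, a, b, c, d] 1 ρ = ![l, ρ, b, c, d] ∧
      Function.update ![l, a, b, c, d] 2 ρ = ![l, a, ρ, c, d] ∧
      Function.update ![l, a, b, c, d] 3 ρ = ![l, a, b, ρ, d] ∧
      Function.update ![l, a, b, c, d] 4 ρ = ![l, a, b, c, ρ] := fun ρ => by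
    refine ⟨?_, ?_, ?_, ?_, ?_⟩ <;> ext i <;> fin_cases i <;> rfl
  rw [covD_four]
  simp only [covD, e, Fin.sum_univ_five, u]
  simp only [Matrix.cons_val, Matrix.cons_val_zero, Matrix.cons_val_one, Fin.succ_zero_eq_one,
    show Fin.succ (1 : Fin 5) = 2 from rfl, show Fin.succ (2 : Fin 5) = 3 from rfl,
    show Fin.succ (3 : Fin 5) = 4 from rfl, show Fin.succ (4 : Fin 5) = 5 from rfl]
  ring

/-- The metric trace `g^{ab} A_{ab}`. -/
def metricTrace (h : Fin n → Fin n → ℝ) (A : Fin n → Fin n → ℝ) : ℝ :=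
  ∑ a, ∑ b, h a b * A a b

lemma metricTrace_sub (h A B : Fin n → Fin n → ℝ) :
    metricTrace h (fun a b => A a b - B a b) = metricTrace h A - metricTrace h B := by
  simp [metricTrace, mul_sub, Finset.sum_sub_distrib]

lemma metricTrace_sum (h : Fin n → Fin n → ℝ) (k : Fin n → ℝ)
    (A : Fin n → Fin n → Fin n → ℝ) :
    metricTrace h (fun a b => ∑ ρ, k ρ * A ρ a b) = ∑ ρ, k ρ * metricTrace h (A ρ) := by
  simp only [metricTrace, Finset.mul_sum]
  rw [Finset.sum_comm]
  rw [Finset.sum_congr rfl fun a _ => Finset.sum_comm]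
  rw [Finset.sum_comm, Finset.sum_congr rfl fun a _ => Finset.sum_comm]
  refine Finset.sum_congr rfl fun ρ _ => Finset.sum_congr rfl fun a _ =>
    Finset.sum_congr rfl fun b _ => ?_
  ring

lemma IsMetric.smooth_metricTrace (hg : IsMetric g ginv) {A : Pt n → Fin n → Fin n → ℝ}
    (hA : ∀ a b, ContDiff ℝ (⊤ : ℕ∞) fun x => A x a b) :
    ContDiff ℝ (⊤ : ℕ∞) fun x => metricTrace (ginv x) (A x) :=
  ContDiff.sum fun a _ => ContDiff.sum fun b _ => (hg.2.2.1 a b).mul (hA a b)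

lemma IsMetric.pd_metricTrace (hg : IsMetric g ginv) {A : Pt n → Fin n → Fin n → ℝ}
    (hA : ∀ a b, ContDiff ℝ (⊤ : ℕ∞) fun x => A x a b) (l : Fin n) (x : Pt n) :
    pd l (fun y => metricTrace (ginv y) (A y)) x =
      metricTrace (ginv x) fun a b => pd l (fun y => A y a b) x -
        ∑ ρ, christoffel g ginv x ρ l a * A x ρ b -
        ∑ ρ, christoffel g ginv x ρ l b * A x a ρ := by
  have hH := hg.2.2.1
  have d : ∀ a b, pd l (fun y => ginv y a b) x =
      -(∑ ρ, christoffel g ginv x a l ρ * ginv x ρ b +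
        ∑ ρ, ginv x a ρ * christoffel g ginv x b l ρ) := fun a b => by
    have := congrFun (congrFun (hg.matPd_inv l x) a) b
    simpa [matPd, metricMat, connMat, Matrix.mul_apply] using this
  have e1 : pd l (fun y => metricTrace (ginv y) (A y)) x = ∑ a, ∑ b,
      (pd l (fun y => ginv y a b) x * A x a b + ginv x a b * pd l (fun y => A y a b) x) := by
    simp only [metricTrace]
    rw [pd_sum _ fun a => ContDiff.sum fun b _ => (hH a b).mul (hA a b)]
    refine Finset.sum_congr rfl fun a _ => ?_
    rw [pd_sum _ fun b => (hH a b).mul (hA a b)]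
    exact Finset.sum_congr rfl fun b _ => pd_mul (hH a b) (hA a b) l x
  have t1 : ∑ a, ∑ b, ∑ ρ, christoffel g ginv x a l ρ * ginv x ρ b * A x a b =
      ∑ a, ∑ b, ∑ ρ, ginv x a b * (christoffel g ginv x ρ l a * A x ρ b) := by
    simp only [Finset.sum_comm (s := Finset.univ) (t := Finset.univ)
      (f := fun b ρ => christoffel g ginv x _ l ρ * ginv x ρ b * A x _ b)]
    rw [Finset.sum_comm]
    refine Finset.sum_congr rfl fun a _ => ?_
    rw [Finset.sum_comm]
    refine Finset.sum_congr rfl fun b _ => Finset.sum_congr rfl fun ρ _ => ?_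
    ring
  have t2 : ∑ a, ∑ b, ∑ ρ, ginv x a ρ * christoffel g ginv x b l ρ * A x a b =
      ∑ a, ∑ b, ∑ ρ, ginv x a b * (christoffel g ginv x ρ l b * A x a ρ) := by
    refine Finset.sum_congr rfl fun a _ => ?_
    rw [Finset.sum_comm]
    refine Finset.sum_congr rfl fun b _ => Finset.sum_congr rfl fun ρ _ => ?_
    ring
  rw [e1]
  simp only [metricTrace, mul_sub, Finset.mul_sum, Finset.sum_sub_distrib, ← t1, ← t2, d,
    Finset.sum_add_distrib, neg_mul, add_mul, Finset.sum_mul, Finset.sum_neg_distrib]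
  ring

/-- The double trace `g^{ac} g^{bd} T_{abcd}`. -/
def doubleTrace (h : Fin n → Fin n → ℝ) (T : (Fin 4 → Fin n) → ℝ) : ℝ :=
  metricTrace h fun b d => metricTrace h fun a c => T ![a, b, c, d]

lemma IsMetric.pd_doubleTrace (hg : IsMetric g ginv) {T : Tensor n 4}
    (hT : ∀ idx, ContDiff ℝ (⊤ : ℕ∞) fun x => T x idx) (l : Fin n) (x : Pt n) :
    pd l (fun y => doubleTrace (ginv y) (T y)) x =
      metricTrace (ginv x) fun b d => metricTrace (ginv x) fun a c =>
        covD g ginv T x ![l, a, b, c, d] := by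
  simp only [doubleTrace]
  rw [hg.pd_metricTrace fun b d => hg.smooth_metricTrace fun a c => hT _]
  congr 1
  ext b d
  rw [hg.pd_metricTrace fun a c => hT _]
  simp only [← metricTrace_sum, ← metricTrace_sub, covD_four]
  congr 1
  ext a c
  ring

lemma doubleTrace_riemann (hg : IsMetric g ginv) (x : Pt n) :
    doubleTrace (ginv x) (riemann g ginv x) = scalarCurv g ginv x := by
  simp only [doubleTrace, scalarCurv, metricTrace, ricci, riemann]
  refine Finset.sum_congr rfl fun b _ => Finset.sum_congr rfl fun d _ => ?_
  congr 1
  simp only [Matrix.cons_val, Finset.mul_sum]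
  rw [Finset.sum_comm]
  refine Finset.sum_congr rfl fun c _ => ?_
  rw [Finset.sum_comm]
  have h : ∀ ρ, ∑ a, ginv x a c * (g x a ρ * riemannUp g ginv x ρ b c d) =
      (if c = ρ then 1 else 0) * riemannUp g ginv x ρ b c d := fun ρ => by
    rw [← hg.2.2.2 x c ρ, Finset.sum_mul]
    exact Finset.sum_congr rfl fun a _ => by rw [hg.ginv_symm x a c, mul_assoc]
  simp [h]

lemma IsMetric.smooth_christoffel (hg : IsMetric g ginv) (a b c : Fin n) :
    ContDiff ℝ (⊤ : ℕ∞) fun x => christoffel g ginv x a b c :=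
  hg.smooth_connMat b a c

lemma IsMetric.smooth_riemannUp (hg : IsMetric g ginv) (a b c d : Fin n) :
    ContDiff ℝ (⊤ : ℕ∞) fun x => riemannUp g ginv x a b c d := by
  simpa only [curvMat_apply] using hg.smooth_curvMat c d a b

lemma IsMetric.smooth_riemann (hg : IsMetric g ginv) (idx : Fin 4 → Fin n) :
    ContDiff ℝ (⊤ : ℕ∞) fun x => riemann g ginv x idx :=
  ContDiff.sum fun _ _ => (hg.2.1 _ _).mul (hg.smooth_riemannUp _ _ _ _)

lemma IsMetric.smooth_covD (hg : IsMetric g ginv) {q : ℕ} {T : Tensor n q}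
    (hT : ∀ idx, ContDiff ℝ (⊤ : ℕ∞) fun x => T x idx) (idx : Fin (q + 1) → Fin n) :
    ContDiff ℝ (⊤ : ℕ∞) fun x => covD g ginv T x idx :=
  ((hT _).pd _).sub (ContDiff.sum fun _ _ => ContDiff.sum fun _ _ =>
    (hg.smooth_christoffel _ _ _).mul (hT _))

lemma IsMetric.smooth_scalarCurv (hg : IsMetric g ginv) :
    ContDiff ℝ (⊤ : ℕ∞) (scalarCurv g ginv) :=
  ContDiff.sum fun _ _ => ContDiff.sum fun _ _ => (hg.2.2.1 _ _).mul
    (ContDiff.sum fun _ _ => hg.smooth_riemannUp _ _ _ _)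

/-- On a 2-symmetric space the gradient of the scalar curvature is parallel. -/
lemma TwoSymmetric.pd_pd_scalarCurv (hg : IsMetric g ginv) (h2 : TwoSymmetric g ginv)
    (m l : Fin n) (x : Pt n) :
    pd m (fun y => pd l (scalarCurv g ginv) y) x =
      ∑ ρ, christoffel g ginv x ρ m l * pd ρ (scalarCurv g ginv) x := by
  have hS := hg.smooth_covD hg.smooth_riemann
  have grad : ∀ l x, pd l (scalarCurv g ginv) x = metricTrace (ginv x) fun b d =>
      metricTrace (ginv x) fun a c => covD g ginv (riemann g ginv) x ![l, a, b, c, d] := by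
    intro l x
    rw [← hg.pd_doubleTrace hg.smooth_riemann]
    simp only [doubleTrace_riemann hg]
  have hess := hg.pd_doubleTrace
    (T := fun y idx => covD g ginv (riemann g ginv) y ![l, idx 0, idx 1, idx 2, idx 3])
    (fun idx => hS _) m x
  have hz : ∀ a b c d, covD g ginv (fun y idx =>
      covD g ginv (riemann g ginv) y ![l, idx 0, idx 1, idx 2, idx 3] : Tensor n 4) x
        ![m, a, b, c, d] = ∑ ρ, christoffel g ginv x ρ m l *
          covD g ginv (riemann g ginv) x ![ρ, a, b, c, d] := fun a b c d => by
    rw [← sub_eq_zero, ← covD_five]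
    exact h2 x _
  simp only [hz, metricTrace_sum, ← grad] at hess
  rw [← hess]
  simp only [grad]
  rfl

end Contraction

/-! ## Consequences of a parallel one-form -/

section Parallel

variable {n : ℕ} {g ginv : Pt n → Fin n → Fin n → ℝ}

lemma riemannUp_antisymm (x : Pt n) (a b c d : Fin n) :
    riemannUp g ginv x a b c d = -riemannUp g ginv x a b d c := by
  simpa [curvMat_apply] using
    congrFun (congrFun (curvMat_antisymm (g := g) (ginv := ginv) c d x) a) b

/-- If the second slot of the curvature annihilates `v`, then so does the last one. -/
lemma IsMetric.riemannUp_sum_last_eq_zero (hg : IsMetric g ginv) (x : Pt n) {v : Fin n → ℝ}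
    (hv : ∀ a c d, ∑ b, riemannUp g ginv x a b c d * v b = 0) (a b c : Fin n) :
    ∑ d, riemannUp g ginv x a b c d * v d = 0 := by
  set K : Fin n → Matrix (Fin n) (Fin n) ℝ := fun c => ∑ d, v d • curvMat g ginv c d x with hK
  have K_apply : ∀ a b c, K c a b = ∑ d, riemannUp g ginv x a b c d * v d := fun a b c => by
    simp [hK, Matrix.sum_apply, curvMat_apply, mul_comm]
  have K_symm : ∀ a b c, K c a b = K b a c := fun a b c => by
    rw [K_apply, K_apply, ← sub_eq_zero, ← neg_eq_zero, ← Finset.sum_sub_distrib,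
      ← Finset.sum_neg_distrib, ← hv a b c]
    refine Finset.sum_congr rfl fun d _ => ?_
    linear_combination -v d * hg.algebraic_bianchi x a b c d +
      v d * riemannUp_antisymm (g := g) (ginv := ginv) x a c d b
  have GK_skew : ∀ c, (K c).transpose * metricMat g x + metricMat g x * K c = 0 := fun c => by
    simp only [hK, Matrix.transpose_sum, Matrix.transpose_smul, Finset.sum_mul, Finset.mul_sum,
      Matrix.smul_mul, Matrix.mul_smul, ← Finset.sum_add_distrib, ← smul_add, hg.curvMat_skew,
      smul_zero, Finset.sum_const_zero]
  have P_skew : ∀ a b c, (metricMat g x * K c) a b = -(metricMat g x * K c) b a := fun a b c => by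
    have h := congrFun (congrFun (GK_skew c) b) a
    rw [← hg.transpose_metricMat x, ← Matrix.transpose_mul, hg.transpose_metricMat x] at h
    simp only [Matrix.add_apply, Matrix.transpose_apply, Matrix.zero_apply] at h
    linarith
  have P_symm : ∀ a b c, (metricMat g x * K c) a b = (metricMat g x * K b) a c := fun a b c => by
    simp only [Matrix.mul_apply]
    exact Finset.sum_congr rfl fun ρ _ => by rw [K_symm ρ b c]
  have P_zero : ∀ c, metricMat g x * K c = 0 := fun c => by
    ext a b
    simp only [Matrix.zero_apply]
    linarith [P_skew a b c, P_symm b a c, P_skew b c a, P_symm c b a, P_skew c a b, P_symm a c b]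
  have K_zero : K c = 0 := by
    rw [← one_mul (K c), ← hg.inv_mul x, mul_assoc, P_zero, mul_zero]
  rw [← K_apply, K_zero, Matrix.zero_apply]

/-- If `v` is a parallel vector field annihilating the curvature in its last slot, then the
curvature is parallel along `v`. -/
lemma IsMetric.directional_riemannUp (hg : IsMetric g ginv) {v : Pt n → Fin n → ℝ}
    (hs : ∀ a, ContDiff ℝ (⊤ : ℕ∞) fun x => v x a)
    (hp : ∀ x l a, pd l (fun y => v y a) x = -∑ ρ, christoffel g ginv x a l ρ * v x ρ)
    (hv : ∀ x a b c, ∑ d, riemannUp g ginv x a b c d * v x d = 0)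
    (x : Pt n) (a b c d : Fin n) (M : Fin n → Fin n → ℝ)
    (hM : ∀ p q, M p q = ∑ l, christoffel g ginv x p l q * v x l) :
    ∑ l, pd l (fun y => riemannUp g ginv y a b c d) x * v x l =
      ∑ ρ, (-(M a ρ * riemannUp g ginv x ρ b c d) + riemannUp g ginv x a ρ c d * M ρ b +
        M ρ c * riemannUp g ginv x a b ρ d + M ρ d * riemannUp g ginv x a b c ρ) := by
  have hR := hg.smooth_riemannUp
  have hM' : ∀ p q, M p q = ∑ l, christoffel g ginv x p q l * v x l := fun p q => by
    rw [hM]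
    exact Finset.sum_congr rfl fun l _ => by rw [hg.christoffel_symm]
  have dv : ∀ i a b c, ∑ l, pd i (fun y => riemannUp g ginv y a b c l) x * v x l =
      ∑ l, riemannUp g ginv x a b c l * M l i := by
    intro i a b c
    have h := pd_sum Finset.univ (fun l => (hR a b c l).mul (hs l)) i x
    rw [show (fun y => ∑ l, riemannUp g ginv y a b c l * v y l) = fun _ => 0 from
      funext fun y => hv y a b c, pd_const] at h
    simp only [pd_mul (hR _ _ _ _) (hs _), hp, ← hM', Finset.sum_add_distrib, mul_neg,
      Finset.sum_neg_distrib] at h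
    linarith
  have bi : ∀ l, pd l (fun y => riemannUp g ginv y a b c d) x =
      -(∑ ρ, christoffel g ginv x a l ρ * riemannUp g ginv x ρ b c d) +
      ∑ ρ, riemannUp g ginv x a ρ c d * christoffel g ginv x ρ l b -
      (pd c (fun y => riemannUp g ginv y a b d l) x +
        ∑ ρ, christoffel g ginv x a c ρ * riemannUp g ginv x ρ b d l -
        ∑ ρ, riemannUp g ginv x a ρ d l * christoffel g ginv x ρ c b) +
      (pd d (fun y => riemannUp g ginv y a b c l) x +
        ∑ ρ, christoffel g ginv x a d ρ * riemannUp g ginv x ρ b c l -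
        ∑ ρ, riemannUp g ginv x a ρ c l * christoffel g ginv x ρ d b) := by
    intro l
    have h := congrFun (congrFun (hg.bianchi l c d x) a) b
    have e : matPd d (curvMat g ginv l c) x = -matPd d (curvMat g ginv c l) x := by
      rw [← matPd_neg]
      exact congrArg (fun A => matPd d A x) (funext fun y => curvMat_antisymm l c y)
    rw [e, curvMat_antisymm l c] at h
    simp only [Matrix.add_apply, Matrix.sub_apply, Matrix.mul_apply, matPd, connMat,
      Matrix.of_apply, curvMat_apply, Matrix.zero_apply, Matrix.neg_apply, mul_neg, neg_mul] at h
    linarith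
  have k1 : ∀ (k : Fin n → ℝ) (a b : Fin n → Fin n) c,
      ∑ l, (∑ ρ, k ρ * riemannUp g ginv x (a ρ) (b ρ) c l) * v x l = 0 := fun k a b c => by
    simp only [Finset.sum_mul]
    rw [Finset.sum_comm]
    refine Finset.sum_eq_zero fun ρ _ => ?_
    simp only [mul_assoc, ← Finset.mul_sum, hv, mul_zero]
  have k2 : ∀ (k : Fin n → ℝ) (a b : Fin n → Fin n) c,
      ∑ l, (∑ ρ, riemannUp g ginv x (a ρ) (b ρ) c l * k ρ) * v x l = 0 := fun k a b c => by
    simp only [mul_comm _ (k _)]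
    exact k1 k a b c
  have m1 : ∑ l, (∑ ρ, christoffel g ginv x a l ρ * riemannUp g ginv x ρ b c d) * v x l =
      ∑ ρ, M a ρ * riemannUp g ginv x ρ b c d := by
    simp only [hM, Finset.sum_mul]
    rw [Finset.sum_comm]
    exact Finset.sum_congr rfl fun ρ _ => Finset.sum_congr rfl fun l _ => by ring
  have m2 : ∑ l, (∑ ρ, riemannUp g ginv x a ρ c d * christoffel g ginv x ρ l b) * v x l =
      ∑ ρ, riemannUp g ginv x a ρ c d * M ρ b := by
    simp only [hM, Finset.sum_mul, Finset.mul_sum]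
    rw [Finset.sum_comm]
    exact Finset.sum_congr rfl fun ρ _ => Finset.sum_congr rfl fun l _ => by ring
  have m3 : ∑ l, riemannUp g ginv x a b d l * M l c =
      -∑ ρ, M ρ c * riemannUp g ginv x a b ρ d := by
    rw [← Finset.sum_neg_distrib]
    exact Finset.sum_congr rfl fun l _ => by rw [riemannUp_antisymm]; ring
  have m4 : ∑ l, riemannUp g ginv x a b c l * M l d =
      ∑ ρ, M ρ d * riemannUp g ginv x a b c ρ :=
    Finset.sum_congr rfl fun l _ => mul_comm _ _
  simp only [bi, add_mul, sub_mul, neg_mul, Finset.sum_add_distrib, Finset.sum_sub_distrib,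
    Finset.sum_neg_distrib, dv, m1, m2, m3, m4]
  rw [k1 _ (fun ρ => ρ) (fun _ => b), k1 _ (fun ρ => ρ) (fun _ => b), k2 _ (fun _ => a) (fun ρ => ρ),
    k2 _ (fun _ => a) (fun ρ => ρ)]
  ring

/-- The scalar curvature is constant along a parallel vector field that annihilates the
curvature. -/
lemma IsMetric.directional_scalarCurv (hg : IsMetric g ginv) {v : Pt n → Fin n → ℝ}
    (hs : ∀ a, ContDiff ℝ (⊤ : ℕ∞) fun x => v x a)
    (hp : ∀ x l a, pd l (fun y => v y a) x = -∑ ρ, christoffel g ginv x a l ρ * v x ρ)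
    (hv : ∀ x a b c, ∑ d, riemannUp g ginv x a b c d * v x d = 0) (x : Pt n) :
    ∑ l, v x l * pd l (scalarCurv g ginv) x = 0 := by
  have hR := hg.smooth_riemannUp
  set M : Fin n → Fin n → ℝ := fun p q => ∑ l, christoffel g ginv x p l q * v x l with hM
  set Ric : Pt n → Fin n → Fin n → ℝ := fun y b d => ∑ a, riemannUp g ginv y a b a d with hRic
  have hsR : ∀ b d, ContDiff ℝ (⊤ : ℕ∞) fun y => Ric y b d := fun b d =>
    ContDiff.sum fun a _ => hR a b a d
  have grad : ∀ l, pd l (scalarCurv g ginv) x = metricTrace (ginv x) fun b d =>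
      pd l (fun y => Ric y b d) x - ∑ ρ, christoffel g ginv x ρ l b * Ric x ρ d -
        ∑ ρ, christoffel g ginv x ρ l d * Ric x b ρ := fun l => by
    rw [← hg.pd_metricTrace hsR]
    rfl
  have dRic : ∀ b d, ∑ l, v x l * pd l (fun y => Ric y b d) x =
      ∑ ρ, M ρ b * Ric x ρ d + ∑ ρ, M ρ d * Ric x b ρ := fun b d => by
    have e : ∀ l, v x l * pd l (fun y => Ric y b d) x =
        ∑ a, pd l (fun y => riemannUp g ginv y a b a d) x * v x l := fun l => by
      rw [hRic, pd_sum _ fun a => hR a b a d, mul_comm, Finset.sum_mul]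
    simp only [e]
    rw [Finset.sum_comm]
    simp only [hg.directional_riemannUp hs hp hv x _ _ _ _ M fun _ _ => rfl,
      Finset.sum_add_distrib, Finset.sum_neg_distrib, hRic, Finset.mul_sum]
    rw [Finset.sum_comm (f := fun a ρ => M ρ a * riemannUp g ginv x a b ρ d),
      Finset.sum_comm (f := fun a ρ => riemannUp g ginv x a ρ a d * M ρ b),
      Finset.sum_comm (f := fun a ρ => M ρ d * riemannUp g ginv x a b a ρ)]
    simp only [mul_comm (M _ b)]
    ring
  simp only [grad]
  rw [← metricTrace_sum]
  refine Finset.sum_eq_zero fun b _ => Finset.sum_eq_zero fun d _ => ?_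
  have s : ∀ (p : Fin n) (F : Fin n → ℝ),
      ∑ l, v x l * ∑ ρ, christoffel g ginv x ρ l p * F ρ = ∑ ρ, M ρ p * F ρ := fun p F => by
    simp only [hM, Finset.sum_mul, Finset.mul_sum]
    rw [Finset.sum_comm]
    exact Finset.sum_congr rfl fun ρ _ => Finset.sum_congr rfl fun l _ => by ring
  simp only [mul_sub, Finset.sum_sub_distrib, dRic, s b fun ρ => Ric x ρ d, s d fun ρ => Ric x b ρ]
  ring

/-- If the gradient of the scalar curvature is parallel, then it is null. -/
lemma IsMetric.null_of_parallel (hg : IsMetric g ginv)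
    (hpar : ∀ m l x, pd m (fun y => pd l (scalarCurv g ginv) y) x =
      ∑ ρ, christoffel g ginv x ρ m l * pd ρ (scalarCurv g ginv) x) (x : Pt n) :
    ∑ μ, ∑ ν, ginv x μ ν * pd μ (scalarCurv g ginv) x * pd ν (scalarCurv g ginv) x = 0 := by
  set w : Pt n → Matrix (Fin n) Unit ℝ := fun y => Matrix.of fun a _ =>
    pd a (scalarCurv g ginv) y with hw
  have hws : SmoothMat w := fun a _ => hg.smooth_scalarCurv.pd a
  have hwp : ∀ γ y, matPd γ w y = (connMat g ginv γ y).transpose * w y := fun γ y => by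
    ext a u
    simpa [matPd, hw, connMat, Matrix.mul_apply] using hpar γ a y
  have hker := hg.curvMat_transpose_mul_eq_zero hws hwp
  set V : Pt n → Matrix (Fin n) Unit ℝ := fun y => metricMat ginv y * w y with hV
  have hVs : SmoothMat V := hg.smooth_inv.mul hws
  have hVp : ∀ γ y, matPd γ V y = -(connMat g ginv γ y * V y) := fun γ y => by
    rw [hV, matPd_mul hg.smooth_inv hws, hg.matPd_inv, hwp]
    simp only [Matrix.neg_mul, Matrix.add_mul, Matrix.mul_assoc]
    abel
  have hVker : ∀ γ δ y, curvMat g ginv γ δ y * V y = 0 := fun γ δ y => by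
    have e : curvMat g ginv γ δ y * metricMat ginv y =
        -(metricMat ginv y * (curvMat g ginv γ δ y).transpose) := by
      have h := congrArg (fun A => metricMat ginv y * A * metricMat ginv y)
        (hg.curvMat_skew γ δ y)
      simp only [mul_add, add_mul, mul_assoc, hg.mul_inv, mul_one, zero_mul, mul_zero] at h
      rw [← mul_assoc (metricMat ginv y) (metricMat g y), hg.inv_mul, one_mul] at h
      exact eq_neg_of_add_eq_zero_right h
    simp only [hV]
    rw [← Matrix.mul_assoc, e, Matrix.neg_mul, Matrix.mul_assoc, hker, Matrix.mul_zero, neg_zero]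
  have h := hg.directional_scalarCurv (v := fun y a => V y a ()) (fun a => hVs a ())
    (fun y l a => by
      simpa [matPd, connMat, Matrix.mul_apply] using congrFun (congrFun (hVp l y) a) ())
    (fun y a b c => hg.riemannUp_sum_last_eq_zero y (fun a c d => by
      simpa [Matrix.mul_apply, curvMat_apply] using congrFun (congrFun (hVker c d y) a) ()) a b c) x
  rw [← h]
  refine Finset.sum_congr rfl fun μ _ => ?_
  simp only [hV, hw, Matrix.mul_apply, metricMat, Matrix.of_apply, Finset.sum_mul]
  exact Finset.sum_congr rfl fun ν _ => mul_right_comm _ _ _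

end Parallel

/-- In any 2-symmetric semi-Riemannian manifold, either the scalar
curvature `R` is constant, or its gradient `∇_μ R` is a null parallel 1-form. -/
theorem stmt14 {n : ℕ} (g ginv : Pt n → Fin n → Fin n → ℝ) (hg : IsMetric g ginv)
    (h2 : TwoSymmetric g ginv) :
    (∀ x y : Pt n, scalarCurv g ginv x = scalarCurv g ginv y) ∨
    ((∀ x : Pt n,
        (∑ μ, ∑ ν, ginv x μ ν * pd μ (scalarCurv g ginv) x * pd ν (scalarCurv g ginv) x) = 0) ∧
     (∀ x idx, covD g ginv (fun y jdx => pd (jdx 0) (scalarCurv g ginv) y : Tensor n 1) x idx = 0)) := by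
  have hpar := h2.pd_pd_scalarCurv hg
  refine Or.inr ⟨hg.null_of_parallel hpar, fun x idx => ?_⟩
  rw [covD_one, sub_eq_zero]
  exact hpar _ _ x
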